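/- arXiv:1607.02725 — 6 statements merged into one kernel-verified Lean document; each statement's English description precedes it below -/
import Mathlib

section
/- Let n ≥ 2, let p_1, …, p_n be points in the Euclidean plane, and let B ≥ 0 be a real number. Say the pair (i,j) (with 1 ≤ j < i ≤ n) is B-feasible if there exists an (i,j)-partial tour whose bottleneck is at most B. Then for every i with 2 ≤ i ≤ n−1: (a) for every j with 1 ≤ j < i, (i+1, j) is B-feasible if and only if (i, j) is B-feasible and dist(p_i, p_{i+1}) ≤ B; and (b) (i+1, i) is B-feasible if and only if there exists k with 1 ≤ k < i such that (i, k) is B-feasible and dist(p_k, p_{i+1}) ≤ B. -/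
noncomputable section

/-- Points in the Euclidean plane. -/
abbrev Pt := EuclideanSpace ℝ (Fin 2)

/-- The pairs `(x, x')` of elements of `X` with `x < x'` that are consecutive in `X`,
i.e. no element of `X` lies strictly between them. -/
def consecPairs (X : Finset ℕ) : Finset (ℕ × ℕ) :=
  (X ×ˢ X).filter fun q => q.1 < q.2 ∧ ∀ y ∈ X, ¬ (q.1 < y ∧ y < q.2)

/-- The chain bottleneck of `X`: the maximum distance between consecutive elements of `X`
(`0` if `X` has at most one element). -/
def chainBot (p : ℕ → Pt) (X : Finset ℕ) : ℝ :=
  (consecPairs X).fold max 0 fun q => dist (p q.1) (p q.2)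

/-- `(S, T)` is an `(i,j)`-partial tour: `S ∪ T = {1,…,i}`, `S ∩ T = {1}`,
`max S = i` and `max T = j`. -/
def IsPartialTour (i j : ℕ) (S T : Finset ℕ) : Prop :=
  S ∪ T = Finset.Icc 1 i ∧ S ∩ T = {1} ∧ S.max = (i : WithBot ℕ) ∧ T.max = (j : WithBot ℕ)

/-- `(i, j)` is `B`-feasible: there is an `(i,j)`-partial tour with bottleneck at most `B`. -/
def BFeasible (p : ℕ → Pt) (B : ℝ) (i j : ℕ) : Prop :=
  ∃ S T : Finset ℕ, IsPartialTour i j S T ∧ max (chainBot p S) (chainBot p T) ≤ B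

/-- All consecutive distances in `X` are at most `B`. -/
def ChainLe (p : ℕ → Pt) (B : ℝ) (X : Finset ℕ) : Prop :=
  ∀ x ∈ X, ∀ y ∈ X, x < y → (∀ z ∈ X, ¬ (x < z ∧ z < y)) → dist (p x) (p y) ≤ B

theorem chainBot_le_iff (p : ℕ → Pt) (B : ℝ) (hB : 0 ≤ B) (X : Finset ℕ) :
    chainBot p X ≤ B ↔ ChainLe p B X := by
  unfold chainBot ChainLe consecPairs
  rw [Finset.fold_max_le]
  simp only [Finset.mem_filter, Finset.mem_product, Prod.forall]
  constructor
  · intro h x hx y hy hxy hz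
    exact h.2 x y ⟨⟨hx, hy⟩, hxy, hz⟩
  · intro h
    exact ⟨hB, fun x y hh => h x hh.1.1 y hh.1.2 hh.2.1 hh.2.2⟩

theorem max_eq_coe_iff (X : Finset ℕ) (m : ℕ) :
    X.max = (m : WithBot ℕ) ↔ m ∈ X ∧ ∀ x ∈ X, x ≤ m := by
  constructor
  · intro h
    exact ⟨Finset.mem_of_max h, fun x hx => Finset.le_max_of_eq hx h⟩
  · rintro ⟨h1, h2⟩
    apply le_antisymm
    · exact Finset.max_le fun x hx => WithBot.coe_le_coe.2 (h2 x hx)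
    · exact Finset.le_max h1

theorem chainLe_insert (p : ℕ → Pt) (B : ℝ) (X : Finset ℕ) (m a : ℕ) (hm : m ∈ X)
    (hmax : ∀ x ∈ X, x ≤ m) (ha : m < a) :
    ChainLe p B (insert a X) ↔ ChainLe p B X ∧ dist (p m) (p a) ≤ B := by
  unfold ChainLe
  constructor
  · intro h
    refine ⟨fun x hx y hy hxy hz => h x (by simp [hx]) y (by simp [hy]) hxy ?_,
      h m (by simp [hm]) a (by simp) ha ?_⟩
    · intro z hzX
      have := hmax y hy
      rcases Finset.mem_insert.1 hzX with rfl | h'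
      · omega
      · exact hz z h'
    · intro z hzX
      rcases Finset.mem_insert.1 hzX with rfl | h'
      · omega
      · have := hmax z h'
        omega
  · rintro ⟨h1, h2⟩ x hx y hy hxy hz
    rcases Finset.mem_insert.1 hx with rfl | hx'
    · rcases Finset.mem_insert.1 hy with rfl | hy'
      · omega
      · have := hmax y hy'
        omega
    · have hxm := hmax x hx'
      rcases Finset.mem_insert.1 hy with rfl | hy'
      · have := hz m (by simp [hm])
        have : x = m := by omega
        subst this
        exact h2
      · exact h1 x hx' y hy' hxy fun z hzX => hz z (by simp [hzX])

theorem bFeasible_iff (p : ℕ → Pt) (B : ℝ) (hB : 0 ≤ B) (i j : ℕ) :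
    BFeasible p B i j ↔ ∃ S T : Finset ℕ,
      (∀ x, x ∈ S ∨ x ∈ T ↔ 1 ≤ x ∧ x ≤ i) ∧ (∀ x, x ∈ S ∧ x ∈ T ↔ x = 1) ∧
      (i ∈ S ∧ ∀ x ∈ S, x ≤ i) ∧ (j ∈ T ∧ ∀ x ∈ T, x ≤ j) ∧
      ChainLe p B S ∧ ChainLe p B T := by
  unfold BFeasible IsPartialTour
  simp only [max_le_iff, chainBot_le_iff p B hB, max_eq_coe_iff, Finset.ext_iff,
    Finset.mem_union, Finset.mem_inter, Finset.mem_Icc, Finset.mem_singleton, and_assoc]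

theorem stmt_2 (n : ℕ) (hn : 2 ≤ n) (p : ℕ → Pt) (B : ℝ) (hB : 0 ≤ B)
    (i : ℕ) (hi2 : 2 ≤ i) (hi : i ≤ n - 1) :
    (∀ j, 1 ≤ j → j < i →
        (BFeasible p B (i + 1) j ↔ BFeasible p B i j ∧ dist (p i) (p (i + 1)) ≤ B)) ∧
    (BFeasible p B (i + 1) i ↔
        ∃ k, 1 ≤ k ∧ k < i ∧ BFeasible p B i k ∧ dist (p k) (p (i + 1)) ≤ B) := by
  simp only [bFeasible_iff p B hB]
  refine ⟨fun j hj1 hji => ⟨?_, ?_⟩, ?_, ?_⟩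
  · rintro ⟨S, T, hU, hI, ⟨hS, hSm⟩, ⟨hT, hTm⟩, cS, cT⟩
    have hiS : i ∈ S := by
      rcases (hU i).2 (by omega) with h | h
      · exact h
      · have := hTm i h
        omega
    have hins : insert (i + 1) (S.erase (i + 1)) = S := Finset.insert_erase hS
    have hm : ∀ x ∈ S.erase (i + 1), x ≤ i := by
      intro x hx
      have := Finset.mem_erase.1 hx
      have := hSm x this.2
      omega
    have hmi : i ∈ S.erase (i + 1) := by simp [hiS]
    rw [← hins, chainLe_insert p B _ i (i + 1) hmi hm (by omega)] at cS
    refine ⟨⟨S.erase (i + 1), T, ?_, ?_, ⟨hmi, hm⟩, ⟨hT, hTm⟩, cS.1, cT⟩, cS.2⟩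
    · intro x
      have h1 := hU x
      have h2 := hTm x
      simp only [Finset.mem_erase]
      grind
    · intro x
      have h1 := hI x
      simp only [Finset.mem_erase]
      grind
  · rintro ⟨⟨S, T, hU, hI, ⟨hS, hSm⟩, ⟨hT, hTm⟩, cS, cT⟩, hd⟩
    refine ⟨insert (i + 1) S, T, ?_, ?_, ⟨by simp, ?_⟩, ⟨hT, hTm⟩,
      (chainLe_insert p B S i (i + 1) hS hSm (by omega)).2 ⟨cS, hd⟩, cT⟩
    · intro x
      have h1 := hU x
      simp only [Finset.mem_insert]
      grind
    · intro x
      have h1 := hI x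
      have h2 := hTm x
      simp only [Finset.mem_insert]
      grind
    · intro x hx
      rcases Finset.mem_insert.1 hx with rfl | h
      · exact le_rfl
      · have := hSm x h
        omega
  · rintro ⟨S, T, hU, hI, ⟨hS, hSm⟩, ⟨hT, hTm⟩, cS, cT⟩
    have h1S : 1 ∈ S := ((hI 1).2 rfl).1
    have hins : insert (i + 1) (S.erase (i + 1)) = S := Finset.insert_erase hS
    have h1e : 1 ∈ S.erase (i + 1) := Finset.mem_erase.2 ⟨by omega, h1S⟩
    obtain ⟨k, hk⟩ := Finset.max_of_mem h1e
    obtain ⟨hkS, hkm⟩ := (max_eq_coe_iff _ _).1 hk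
    have hk1 := hkm 1 h1e
    have hki : k < i := by
      have h := Finset.mem_erase.1 hkS
      have h2 := hSm k h.2
      have h3 : k ≠ i := by
        rintro rfl
        have := (hI k).1 ⟨h.2, hT⟩
        omega
      omega
    rw [← hins, chainLe_insert p B _ k (i + 1) hkS hkm (by omega)] at cS
    refine ⟨k, hk1, hki, ⟨T, S.erase (i + 1), ?_, ?_, ⟨hT, hTm⟩, ⟨hkS, hkm⟩, cT, cS.1⟩, cS.2⟩
    · intro x
      have h1 := hU x
      have h2 := hTm x
      simp only [Finset.mem_erase]
      grind
    · intro x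
      have h1 := hI x
      simp only [Finset.mem_erase]
      grind
  · rintro ⟨k, hk1, hki, ⟨S, T, hU, hI, ⟨hS, hSm⟩, ⟨hT, hTm⟩, cS, cT⟩, hd⟩
    refine ⟨insert (i + 1) T, S, ?_, ?_, ⟨by simp, ?_⟩, ⟨hS, hSm⟩,
      (chainLe_insert p B T k (i + 1) hT hTm (by omega)).2 ⟨cT, hd⟩, cS⟩
    · intro x
      have h1 := hU x
      simp only [Finset.mem_insert]
      grind
    · intro x
      have h1 := hI x
      have h2 := hSm x
      simp only [Finset.mem_insert]
      grind
    · intro x hx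
      rcases Finset.mem_insert.1 hx with rfl | h
      · exact le_rfl
      · have := hTm x h
        omega
end
end

section
/- Let P be a finite nonempty set of points in the Euclidean plane, let w : P → ℝ assign a weight to each point, and let q be a point of the plane. Define B := min over p ∈ P of max( w(p), dist(p, q) ). Working in ℝ ∪ {∞} (with the infimum of the empty set equal to ∞), define B₁ := inf { w(p) : p ∈ P and dist(p, q) ≤ w(p) } and B₂ := inf { dist(p, q) : p ∈ P and w(p) < B₁ }. Then B = min(B₁, B₂). -/
noncomputable section

theorem stmt_6 (P : Finset Pt) (hP : P.Nonempty) (w : Pt → ℝ) (q : Pt)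
    (B : ℝ) (hB : B = P.inf' hP fun p => max (w p) (dist p q))
    (B₁ B₂ : WithTop ℝ)
    (hB₁ : B₁ = sInf {x : WithTop ℝ | ∃ p ∈ P, dist p q ≤ w p ∧ x = (w p : WithTop ℝ)})
    (hB₂ : B₂ = sInf {x : WithTop ℝ | ∃ p ∈ P, (w p : WithTop ℝ) < B₁ ∧
        x = (dist p q : WithTop ℝ)}) :
    (B : WithTop ℝ) = min B₁ B₂ := by
  have hbd : ∀ (S : Set (WithTop ℝ)) (f : Pt → ℝ), (∀ x ∈ S, ∃ p ∈ P, x = (f p : WithTop ℝ)) →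
      IsGLB S (sInf S) := by
    intro S f hS
    apply WithTop.isGLB_sInf'
    refine ⟨((P.inf' hP f : ℝ) : WithTop ℝ), ?_⟩
    intro x hx
    obtain ⟨p, hp, rfl⟩ := hS x hx
    exact WithTop.coe_le_coe.2 (Finset.inf'_le f hp)
  have h1 := hbd {x : WithTop ℝ | ∃ p ∈ P, dist p q ≤ w p ∧ x = (w p : WithTop ℝ)} w
    (by rintro x ⟨p, hp, -, h⟩; exact ⟨p, hp, h⟩)
  have h2 := hbd {x : WithTop ℝ | ∃ p ∈ P, (w p : WithTop ℝ) < B₁ ∧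
        x = (dist p q : WithTop ℝ)} (fun p => dist p q)
    (by rintro x ⟨p, hp, -, h⟩; exact ⟨p, hp, h⟩)
  rw [← hB₁] at h1
  rw [← hB₂] at h2
  have hle : ∀ p ∈ P, B ≤ max (w p) (dist p q) := by
    intro p hp
    rw [hB]
    exact Finset.inf'_le (fun p => max (w p) (dist p q)) hp
  apply le_antisymm
  · apply le_min
    · apply h1.2
      rintro x ⟨p, hp, h, rfl⟩
      have := hle p hp
      rw [max_eq_left h] at this
      exact WithTop.coe_le_coe.2 this
    · apply h2.2
      rintro x ⟨p, hp, h, rfl⟩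
      have := hle p hp
      have hlt : w p ≤ dist p q := by
        by_contra hc
        exact absurd (h1.1 ⟨p, hp, (not_le.1 hc).le, rfl⟩) (not_le.2 h)
      rw [max_eq_right hlt] at this
      exact WithTop.coe_le_coe.2 this
  · obtain ⟨p, hp, h⟩ := Finset.exists_mem_eq_inf' hP fun p => max (w p) (dist p q)
    rw [← hB] at h
    rcases le_total (dist p q) (w p) with hc | hc
    · rw [max_eq_left hc] at h
      rw [h]
      exact (min_le_left _ _).trans (h1.1 ⟨p, hp, hc, rfl⟩)
    · rw [max_eq_right hc] at h
      rw [h]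
      rcases lt_or_ge (w p : WithTop ℝ) B₁ with hb | hb
      · exact (min_le_right _ _).trans (h2.1 ⟨p, hp, hb, rfl⟩)
      · exact (min_le_left _ _).trans (hb.trans (WithTop.coe_le_coe.2 hc))
end
end

section
/- Let r > 0 and h be real numbers, and let c₁ ≠ c₂ be two points of the Euclidean plane whose second coordinates are both strictly less than h. Then there is at most one point q of the plane satisfying dist(q, c₁) = r, dist(q, c₂) = r, and second coordinate of q strictly greater than h; in other words, two distinct circles of the same radius whose centers lie strictly below the horizontal line y = h intersect in at most one point strictly above that line. -/
/-- Two distinct circles of the same radius whose centers lie strictly below the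
horizontal line `y = h` intersect in at most one point strictly above that line. -/
theorem stmt_9 (r h : ℝ) (hr : 0 < r) (c₁ c₂ : Pt) (hne : c₁ ≠ c₂)
    (hc₁ : c₁ 1 < h) (hc₂ : c₂ 1 < h) :
    ∀ q q' : Pt,
      dist q c₁ = r → dist q c₂ = r → h < q 1 →
      dist q' c₁ = r → dist q' c₂ = r → h < q' 1 →
      q = q' := by
  intro q q' h1 h2 hq h3 h4 hq'
  have key : ∀ x c : Pt, dist x c = r → (x 0 - c 0) ^ 2 + (x 1 - c 1) ^ 2 = r ^ 2 := by
    intro x c hx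
    rw [← hx, EuclideanSpace.dist_eq, Real.sq_sqrt (by positivity)]
    simp [Fin.sum_univ_two, Real.dist_eq, sq_abs]
  have e1 := key _ _ h1
  have e2 := key _ _ h2
  have e3 := key _ _ h3
  have e4 := key _ _ h4
  obtain ⟨a, ha⟩ : ∃ a, a = c₂ 0 - c₁ 0 := ⟨_, rfl⟩
  obtain ⟨b, hb⟩ : ∃ b, b = c₂ 1 - c₁ 1 := ⟨_, rfl⟩
  obtain ⟨s, hs⟩ : ∃ s, s = q 0 - q' 0 := ⟨_, rfl⟩
  obtain ⟨t, ht⟩ : ∃ t, t = q 1 - q' 1 := ⟨_, rfl⟩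
  obtain ⟨v, hv⟩ : ∃ v, v = q 0 + q' 0 - c₁ 0 - c₂ 0 := ⟨_, rfl⟩
  obtain ⟨w, hw⟩ : ∃ w, w = q 1 + q' 1 - c₁ 1 - c₂ 1 := ⟨_, rfl⟩
  have hwpos : 0 < w := by linarith
  have f1 : a * s + b * t = 0 := by subst_vars; linarith
  have f2 : a * v + b * w = 0 := by subst_vars; linarith
  have f3 : s * v + t * w = 0 := by subst_vars; linarith
  have hcross : s * w - t * v = 0 := by
    by_contra hne0
    apply hne
    have ha0 : a = 0 := by
      have : a * (s * w - t * v) = 0 := by linear_combination w * f1 - t * f2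
      exact (mul_eq_zero.mp this).resolve_right hne0
    have hb0 : b = 0 := by
      have : b * (s * w - t * v) = 0 := by linear_combination s * f2 - v * f1
      exact (mul_eq_zero.mp this).resolve_right hne0
    ext i
    fin_cases i
    · show c₁ 0 = c₂ 0
      linarith
    · show c₁ 1 = c₂ 1
      linarith
  have hst : s ^ 2 + t ^ 2 = 0 := by
    have : w * (s ^ 2 + t ^ 2) = 0 := by linear_combination s * hcross + t * f3
    exact (mul_eq_zero.mp this).resolve_left hwpos.ne'
  have hs0 : s = 0 := pow_eq_zero_iff two_ne_zero |>.mp (by linarith [sq_nonneg s, sq_nonneg t])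
  have ht0 : t = 0 := pow_eq_zero_iff two_ne_zero |>.mp (by linarith [sq_nonneg s, sq_nonneg t])
  ext i
  fin_cases i
  · show q 0 = q' 0
    linarith
  · show q 1 = q' 1
    linarith
end

section
/- Let a, b be real numbers and let c₁, c₂ be points of the closed unit square [a, a+1] × [b, b+1] in the Euclidean plane whose second coordinates are strictly less than b+1 and such that the first coordinate of c₁ is strictly less than the first coordinate of c₂. Let q₁ be a point with dist(q₁, c₁) = √2, dist(q₁, c₂) > √2, and second coordinate strictly greater than b+1, and let q₂ be a point with dist(q₂, c₂) = √2, dist(q₂, c₁) > √2, and second coordinate strictly greater than b+1. Then the first coordinate of q₁ is strictly less than the first coordinate of q₂. -/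
/-- If `(px,py)`, `(qx,qy)` lie on the upper half circle and `(rx, ry)` lies strictly outside
the disk, above the axis, with `rx` a convex combination, then `ry` exceeds the combination. -/
lemma above_chord (px py qx qy ry l m : ℝ) (hl : 0 ≤ l) (hm : 0 ≤ m) (hlm : l + m = 1)
    (hP : px ^ 2 + py ^ 2 = 2) (hQ : qx ^ 2 + qy ^ 2 = 2) (hry : 0 < ry)
    (hR : 2 < (l * px + m * qx) ^ 2 + ry ^ 2) : l * py + m * qy < ry := by
  have hm' : m = 1 - l := by linarith
  have key : (l * px + m * qx) ^ 2 + (l * py + m * qy) ^ 2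
      = 2 - l * m * ((px - qx) ^ 2 + (py - qy) ^ 2) := by
    subst hm'
    linear_combination l * hP + (1 - l) * hQ
  have h0 : 0 ≤ l * m * ((px - qx) ^ 2 + (py - qy) ^ 2) := by positivity
  by_contra! h
  nlinarith

/-- For two disks of radius `√2` with centers `c₁`, `c₂` in the closed unit square
`[a, a+1] × [b, b+1]`, centers strictly below the top line `y = b + 1` and with `c₁`
strictly to the left of `c₂`, any point of the circle around `c₁` above the top line
lying strictly outside the disk around `c₂` is strictly to the left of any point of the
circle around `c₂` above the top line lying strictly outside the disk around `c₁`. -/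
theorem stmt_10 (a b : ℝ) (c₁ c₂ : Pt)
    (hc₁ : c₁ 0 ∈ Set.Icc a (a + 1) ∧ c₁ 1 ∈ Set.Icc b (b + 1))
    (hc₂ : c₂ 0 ∈ Set.Icc a (a + 1) ∧ c₂ 1 ∈ Set.Icc b (b + 1))
    (htop₁ : c₁ 1 < b + 1) (htop₂ : c₂ 1 < b + 1) (hx : c₁ 0 < c₂ 0)
    (q₁ q₂ : Pt)
    (hq₁ : dist q₁ c₁ = Real.sqrt 2 ∧ Real.sqrt 2 < dist q₁ c₂ ∧ b + 1 < q₁ 1)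
    (hq₂ : dist q₂ c₂ = Real.sqrt 2 ∧ Real.sqrt 2 < dist q₂ c₁ ∧ b + 1 < q₂ 1) :
    q₁ 0 < q₂ 0 := by
  obtain ⟨h1, h2, h3⟩ := hq₁
  obtain ⟨h4, h5, h6⟩ := hq₂
  rw [EuclideanSpace.dist_eq, Real.sqrt_inj (by positivity) (by norm_num)] at h1 h4
  rw [EuclideanSpace.dist_eq, Real.sqrt_lt_sqrt_iff (by norm_num)] at h2 h5
  simp only [Fin.sum_univ_two, Real.dist_eq, sq_abs] at h1 h2 h4 h5
  by_contra! hle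
  have hd : 0 < q₁ 0 - q₂ 0 + (c₂ 0 - c₁ 0) := by linarith
  obtain ⟨l, hl⟩ : ∃ l, l = (q₁ 0 - q₂ 0) / (q₁ 0 - q₂ 0 + (c₂ 0 - c₁ 0)) := ⟨_, rfl⟩
  have hl0 : 0 ≤ l := by rw [hl]; exact div_nonneg (by linarith) hd.le
  have hl1 : l ≤ 1 := by rw [hl, div_le_one hd]; linarith
  have hle' : l * (q₁ 0 - q₂ 0 + (c₂ 0 - c₁ 0)) = q₁ 0 - q₂ 0 := by
    rw [hl]; field_simp
  have e1 : l * (q₁ 0 - c₁ 0) + (1 - l) * (q₂ 0 - c₂ 0) = q₁ 0 - c₂ 0 := by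
    linear_combination hle'
  have e2 : (1 - l) * (q₁ 0 - c₁ 0) + l * (q₂ 0 - c₂ 0) = q₂ 0 - c₁ 0 := by
    linear_combination -hle'
  have a1 := above_chord _ _ _ _ (q₁ 1 - c₂ 1) l (1 - l) hl0 (by linarith) (by ring) h1 h4
    (by linarith) (by rw [e1]; exact h2)
  have a2 := above_chord _ _ _ _ (q₂ 1 - c₁ 1) (1 - l) l (by linarith) hl0 (by ring) h1 h4
    (by linarith) (by rw [e2]; exact h5)
  linarith
end

section
/- Let n ≥ 3, let M ≥ 1 be an integer, and let w be a symmetric integer weight function on unordered pairs of distinct elements of {1,…,n} with |w(i,j)| ≤ M for all i ≠ j. Consider the complete graph on the 2n vertices a₁, b₁, a₂, b₂, …, a_n, b_n with the symmetric distance function d defined by: d(a_i, b_i) = 0 for all i; d(b_i, a_{i+1}) = −3M for 1 ≤ i ≤ n−1 and d(b_n, a₁) = −3M; d(a_i, b_j) = w(i, j) for all remaining mixed pairs (i.e., i ≠ j and the pair is not of the form (b_i, a_{i+1}) cyclically); and d(a_i, a_j) = d(b_i, b_j) = 3M for all i ≠ j. Let T be the tour (Hamiltonian cycle) a₁, b₁,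 a₂, b₂, …, a_n, b_n, a₁. Then there exists a tour T' with |T \ T'| ≤ 3 and d-weight(T') < d-weight(T) if and only if there exist three pairwise distinct indices i, j, k in {1,…,n} with w(i,j) + w(j,k) + w(i,k) < 0. -/
noncomputable section

/-- `T` is the edge set of a Hamiltonian cycle (a tour) on the finite vertex type `V`:
there is a cyclic permutation of all of `V` whose edges are exactly `T`. -/
def IsTour {V : Type} [Fintype V] [DecidableEq V] (T : Finset (Sym2 V)) : Prop :=
  ∃ σ : Equiv.Perm V, σ.IsCycle ∧ σ.support = Finset.univ ∧
    T = Finset.image (fun v => s(v, σ v)) Finset.univ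

open Finset

theorem fin_succ_val {n : ℕ} [NeZero n] (hn : 3 ≤ n) (i : Fin n) :
    (i + 1).val = if i.val + 1 = n then 0 else i.val + 1 := by
  have h1 : (1 : Fin n).val = 1 := by
    rw [Fin.val_one']; exact Nat.mod_eq_of_lt (by omega)
  rw [Fin.val_add, h1]
  split_ifs with h
  · rw [h]; exact Nat.mod_self n
  · exact Nat.mod_eq_of_lt (by have := i.isLt; omega)

/-- The edge set determined by a map `f`: edges `a_i b_{f i}` and `b_i a_{i+1}`. -/
def edgeSet {n : ℕ} [NeZero n] (f : Fin n → Fin n) : Finset (Sym2 (Fin n × Bool)) :=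
  (univ.image fun i : Fin n => s((i, false), (f i, true))) ∪
    (univ.image fun i : Fin n => s((i, true), (i + 1, false)))

theorem mem_edgeSet {n : ℕ} [NeZero n] (f : Fin n → Fin n) (i j : Fin n) :
    s((i, false), (j, true)) ∈ edgeSet f ↔ j = f i ∨ i = j + 1 := by
  simp only [edgeSet, mem_union, mem_image, mem_univ, true_and, Sym2.eq_iff, Prod.mk.injEq]
  constructor
  · rintro (⟨a, h⟩ | ⟨a, h⟩)
    · simp at h; left; rw [← h.1, h.2]
    · simp at h; right; rw [← h.1, h.2]
  · rintro (h | h)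
    · left; exact ⟨i, by simp [h]⟩
    · right; exact ⟨j, by simp [h]⟩

theorem not_mem_edgeSet {n : ℕ} [NeZero n] (f : Fin n → Fin n) (i j : Fin n) (b : Bool) :
    s((i, b), (j, b)) ∉ edgeSet f := by
  simp only [edgeSet, mem_union, mem_image, mem_univ, true_and, Sym2.eq_iff, Prod.mk.injEq]
  cases b <;> simp

theorem sum_edgeSet {n : ℕ} [NeZero n] (f : Fin n → Fin n)
    (hf : ∀ i, i ≠ f i + 1) (D : Sym2 (Fin n × Bool) → ℤ) :
    ∑ e ∈ edgeSet f, D e = ∑ i, D s((i, false), (f i, true)) +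
      ∑ i, D s((i, true), (i + 1, false)) := by
  unfold edgeSet
  rw [sum_union, sum_image, sum_image]
  · intro a _ b _ h
    simp only [Sym2.eq_iff, Prod.mk.injEq] at h
    simpa using (by tauto : a = b)
  · intro a _ b _ h
    simp only [Sym2.eq_iff, Prod.mk.injEq] at h
    simpa using (by tauto : a = b)
  · rw [Finset.disjoint_left]
    intro e he he'
    simp only [mem_image, mem_univ, true_and] at he he'
    obtain ⟨a, rfl⟩ := he
    obtain ⟨b, hb⟩ := he'
    simp only [Sym2.eq_iff, Prod.mk.injEq] at hb
    simp at hb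
    exact hf a (by rw [← hb.1, hb.2])

theorem card_edgeSet {n : ℕ} [NeZero n] (f : Fin n → Fin n)
    (hf : ∀ i, i ≠ f i + 1) : (edgeSet f).card = 2 * n := by
  have := sum_edgeSet f hf (fun _ => 1)
  simp at this
  omega

/-- forward direction: the three-cycle tour. -/
def tourPerm {n : ℕ} [NeZero n] (f : Equiv.Perm (Fin n)) : Equiv.Perm (Fin n × Bool) where
  toFun v := if v.2 then (v.1 + 1, false) else (f v.1, true)
  invFun v := if v.2 then (f.symm v.1, false) else (v.1 - 1, true)
  left_inv := by rintro ⟨a, b⟩; cases b <;> simp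
  right_inv := by rintro ⟨a, b⟩; cases b <;> simp

theorem tour_forward {n : ℕ} [NeZero n] (hn : 3 ≤ n) (i j k : Fin n) (hij : i < j) (hjk : j < k)
    (f : Equiv.Perm (Fin n)) (h1 : f i = j) (h2 : f j = k) (h3 : f k = i)
    (h4 : ∀ m, m ≠ i → m ≠ j → m ≠ k → f m = m) : IsTour (edgeSet f) := by
  have hT : ∀ m, (tourPerm f) (m, true) = (m + 1, false) := fun m => rfl
  have hF : ∀ m, (tourPerm f) (m, false) = (f m, true) := fun m => rfl
  have hfix : ∀ v, (tourPerm f) v ≠ v := by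
    rintro ⟨a, b⟩; cases b
    · simp [hF]
    · simp [hT]
  set r := (tourPerm f).SameCycle with hr
  have rT : ∀ m, r (m, true) (m + 1, false) := fun m => by
    rw [hr, ← hT]; exact (Equiv.Perm.sameCycle_apply_right).2 (Equiv.Perm.SameCycle.refl _ _)
  have rF : ∀ m, r (m, false) (f m, true) := fun m => by
    rw [hr, ← hF]; exact (Equiv.Perm.sameCycle_apply_right).2 (Equiv.Perm.SameCycle.refl _ _)
  have rtrans : ∀ {a b c}, r a b → r b c → r a c := fun h h' => h.trans h'
  have rsymm : ∀ {a b}, r a b → r b a := fun h => h.symm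
  have run : ∀ (lo : Fin n) (p : ℕ) (hp : p < n), lo.val ≤ p →
      (∀ m : Fin n, lo < m → m.val ≤ p → m ≠ i ∧ m ≠ j ∧ m ≠ k) → r (lo, true) (⟨p, hp⟩, true) := by
    intro lo p
    induction p with
    | zero =>
      intro hp hlo _
      have : lo = ⟨0, hp⟩ := Fin.ext (by simpa using hlo)
      exact this ▸ Equiv.Perm.SameCycle.refl _ _
    | succ p ih =>
      intro hp hlo hm
      rcases Nat.lt_or_ge p lo.val with h | h
      · have : lo = ⟨p + 1, hp⟩ := Fin.ext (by show lo.val = p + 1; omega)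
        exact this ▸ Equiv.Perm.SameCycle.refl _ _
      · have e1 := ih (by omega) h (fun m hm1 hm2 => hm m hm1 (by omega))
        have e2 := rT ⟨p, by omega⟩
        have e3 : (⟨p, by omega⟩ + 1 : Fin n) = ⟨p + 1, hp⟩ := by
          apply Fin.ext; rw [fin_succ_val hn]; show (if p + 1 = n then 0 else p + 1) = p + 1; split_ifs <;> omega
        rw [e3] at e2
        have e4 := rF ⟨p + 1, hp⟩
        obtain ⟨g1, g2, g3⟩ := hm ⟨p + 1, hp⟩ (by rw [Fin.lt_def]; show lo.val < p + 1; omega) (le_refl _)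
        rw [h4 _ g1 g2 g3] at e4
        exact rtrans e1 (rtrans e2 e4)
  have hik : i.val < j.val := hij
  have hjk' : j.val < k.val := hjk
  have hkn := k.isLt
  -- links
  have pre : ∀ (lo m : Fin n), lo < m →
      (∀ q : Fin n, lo < q → q < m → q ≠ i ∧ q ≠ j ∧ q ≠ k) → r (lo, true) (m, false) := by
    intro lo m hlm hq
    have hlm' : lo.val < m.val := hlm
    have e1 := run lo (m.val - 1) (by omega) (by omega)
      (fun q h h' => hq q h (by rw [Fin.lt_def]; omega))
    have e2 := rT ⟨m.val - 1, by omega⟩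
    have e3 : (⟨m.val - 1, by omega⟩ + 1 : Fin n) = m := by
      apply Fin.ext; rw [fin_succ_val hn]
      show (if m.val - 1 + 1 = n then 0 else m.val - 1 + 1) = m.val
      split_ifs <;> omega
    rw [e3] at e2
    exact rtrans e1 e2
  have l1 : r (i, true) (k, true) := by
    have := pre i j hij (fun q h h' => by
      simp only [Fin.lt_def, ne_eq, Fin.ext_iff] at *; omega)
    have e := rF j
    rw [h2] at e
    exact rtrans this e
  have l2 : r (j, true) (i, true) := by
    have := pre j k hjk (fun q h h' => by
      simp only [Fin.lt_def, ne_eq, Fin.ext_iff] at *; omega)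
    have e := rF k
    rw [h3] at e
    exact rtrans this e
  have allT : ∀ p : Fin n, r (i, true) (p, true) := by
    intro p
    by_cases hkp : k ≤ p
    · refine rtrans l1 (run k p.val p.isLt hkp (fun q h h' => ?_))
      simp only [Fin.lt_def, Fin.le_def, ne_eq, Fin.ext_iff] at *; omega
    by_cases hjp : j ≤ p
    · refine rtrans (rsymm l2) (run j p.val p.isLt hjp (fun q h h' => ?_))
      simp only [Fin.lt_def, Fin.le_def, ne_eq, Fin.ext_iff] at *; omega
    by_cases hip : i ≤ p
    · refine run i p.val p.isLt hip (fun q h h' => ?_)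
      simp only [Fin.lt_def, Fin.le_def, ne_eq, Fin.ext_iff] at *; omega
    simp only [Fin.le_def] at hip hjp hkp
    have e1 := run ⟨0, by omega⟩ p.val p.isLt (by simp) (fun q h h' => by
      simp only [Fin.lt_def, ne_eq, Fin.ext_iff] at *; omega)
    have e2 := rF ⟨0, by omega⟩
    rw [h4 ⟨0, by omega⟩ (by simp only [ne_eq, Fin.ext_iff]; omega)
      (by simp only [ne_eq, Fin.ext_iff]; omega) (by simp only [ne_eq, Fin.ext_iff]; omega)] at e2
    have e3 := rT ⟨n - 1, by omega⟩
    have e4 : (⟨n - 1, by omega⟩ + 1 : Fin n) = ⟨0, by omega⟩ := by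
      apply Fin.ext; rw [fin_succ_val hn]
      show (if n - 1 + 1 = n then 0 else n - 1 + 1) = 0
      split_ifs <;> omega
    rw [e4] at e3
    have e5 := run k (n - 1) (by omega) (by omega) (fun q h h' => by
      simp only [Fin.lt_def, ne_eq, Fin.ext_iff] at *; omega)
    exact rtrans l1 (rtrans e5 (rtrans e3 (rtrans e2 e1)))
  have all : ∀ v, r (i, true) v := by
    rintro ⟨p, b⟩
    cases b
    · exact rtrans (allT (f p)) (rsymm (rF p))
    · exact allT p
  refine ⟨tourPerm f, ⟨(i, true), hfix _, fun y _ => all y⟩, ?_, ?_⟩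
  · ext v; simp [hfix v]
  · ext e
    simp only [edgeSet, mem_union, mem_image, mem_univ, true_and, Prod.exists, Bool.exists_bool,
      hT, hF]
    constructor
    · rintro (⟨a, h⟩ | ⟨a, h⟩)
      · exact ⟨a, Or.inl h⟩
      · exact ⟨a, Or.inr h⟩
    · rintro ⟨a, h | h⟩
      · exact Or.inl ⟨a, h⟩
      · exact Or.inr ⟨a, h⟩

theorem sdiff_card_le {n : ℕ} [NeZero n] (f : Fin n → Fin n) (S : Finset (Fin n))
    (h : ∀ m, m ∉ S → f m = m) : (edgeSet (id : Fin n → Fin n) \ edgeSet f).card ≤ S.card := by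
  refine le_trans (card_le_card ?_)
    (card_image_le (s := S) (f := fun i : Fin n => s((i, false), (i, true))))
  intro e he
  rw [mem_sdiff] at he
  obtain ⟨h1, h2⟩ := he
  simp only [edgeSet, mem_union, mem_image, mem_univ, true_and, id] at h1 h2
  push Not at h2
  rcases h1 with ⟨a, rfl⟩ | ⟨a, rfl⟩
  · refine mem_image_of_mem _ ?_
    by_contra hS
    exact h2.1 a (by rw [h a hS])
  · exact absurd rfl (h2.2 a)

theorem le_sdiff_card {n : ℕ} [NeZero n] (f : Fin n → Fin n) (S : Finset (Fin n))
    (hn : 3 ≤ n)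
    (h : ∀ m, m ∈ S → f m ≠ m) : S.card ≤ (edgeSet (id : Fin n → Fin n) \ edgeSet f).card := by
  rw [← card_image_of_injective S (f := fun i : Fin n => s((i, false), (i, true)))]
  · apply card_le_card
    intro e he
    rw [mem_image] at he
    obtain ⟨a, ha, rfl⟩ := he
    rw [mem_sdiff, mem_edgeSet, mem_edgeSet]
    refine ⟨Or.inl rfl, ?_⟩
    rintro (h' | h')
    · exact h a ha h'.symm
    · have := congrArg Fin.val h'
      rw [fin_succ_val hn] at this
      split_ifs at this <;> omega
  · intro a b h
    simpa [Sym2.eq_iff] using h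

/-- An edge set built from a transposition is not a tour. -/
theorem not_tour_swap {n : ℕ} [NeZero n] (hn : 3 ≤ n) (x y : Fin n) (hxy : x < y)
    (f : Fin n → Fin n) (h1 : f x = y) (h2 : f y = x)
    (h4 : ∀ m, m ≠ x → m ≠ y → f m = m) : ¬ IsTour (edgeSet f) := by
  rintro ⟨σ, hc, hs, hT⟩
  let P : Fin n × Bool → Prop := fun v =>
    if v.2 then x.val ≤ v.1.val ∧ v.1.val < y.val else x.val < v.1.val ∧ v.1.val ≤ y.val
  have hxy' : x.val < y.val := hxy
  have key : ∀ i j : Fin n, j = f i ∨ i = j + 1 → (P (i, false) ↔ P (j, true)) := by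
    intro i j h
    simp only [P]
    rcases h with rfl | rfl
    · by_cases hx : i = x
      · subst hx; rw [h1]; simp
      by_cases hy : i = y
      · subst hy; rw [h2]; simp [hxy']
      rw [h4 i hx hy]
      rw [Fin.ext_iff] at hx hy
      simp; omega
    · rw [fin_succ_val hn]
      have := y.isLt
      have := j.isLt
      simp only [Bool.false_eq_true, if_false, if_true]
      split_ifs <;> omega
  have step : ∀ v, P v ↔ P (σ v) := by
    intro v
    have hm : s(v, σ v) ∈ edgeSet f := by rw [hT]; exact mem_image_of_mem _ (mem_univ v)
    generalize σ v = u at hm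
    obtain ⟨a, b⟩ := v
    obtain ⟨c, e⟩ := u
    cases b <;> cases e
    · exact absurd hm (not_mem_edgeSet _ _ _ _)
    · exact key _ _ ((mem_edgeSet f _ _).1 hm)
    · rw [Sym2.eq_swap] at hm
      exact (key _ _ ((mem_edgeSet f _ _).1 hm)).symm
    · exact absurd hm (not_mem_edgeSet _ _ _ _)
  have hsup : ∀ v, σ v ≠ v := fun v => by
    rw [← Equiv.Perm.mem_support, hs]; exact mem_univ v
  have hsc : σ.SameCycle (x, true) (x, false) := hc.sameCycle (hsup _) (hsup _)
  obtain ⟨m, hm⟩ := hsc.exists_pow_eq'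
  have : ∀ m : ℕ, P ((σ ^ m) (x, true)) := by
    intro m
    induction m with
    | zero => simpa [P] using hxy
    | succ m ih => rw [pow_succ', Equiv.Perm.mul_apply]; exact (step _).1 ih
  have h := this m
  rw [hm.2] at h
  simp [P] at h

/-- Correctness of the reduction from Negative Edge-Weighted Triangle to 3-opt Detection.
Vertex `(i, false)` plays the role of `aᵢ` and `(i, true)` the role of `bᵢ`. -/
theorem stmt_11 (n : ℕ) [NeZero n] (hn : 3 ≤ n) (M : ℤ) (hM : 1 ≤ M)
    (w : Fin n → Fin n → ℤ) (hw : ∀ i j, w i j = w j i)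
    (hwbd : ∀ i j : Fin n, i ≠ j → |w i j| ≤ M)
    (d : Fin n × Bool → Fin n × Bool → ℤ) (hd : ∀ u v, d u v = d v u)
    (hd₁ : ∀ i : Fin n, d (i, false) (i, true) = 0)
    (hd₂ : ∀ i : Fin n, d (i, true) (i + 1, false) = -(3 * M))
    (hd₃ : ∀ i j : Fin n, i ≠ j → i ≠ j + 1 → d (i, false) (j, true) = w i j)
    (hd₄ : ∀ i j : Fin n, i ≠ j → d (i, false) (j, false) = 3 * M)
    (hd₅ : ∀ i j : Fin n, i ≠ j → d (i, true) (j, true) = 3 * M)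
    (T : Finset (Sym2 (Fin n × Bool)))
    (hT : T = (Finset.univ.image fun i : Fin n => s((i, false), (i, true))) ∪
              (Finset.univ.image fun i : Fin n => s((i, true), (i + 1, false)))) :
    (∃ T' : Finset (Sym2 (Fin n × Bool)), IsTour T' ∧ (T \ T').card ≤ 3 ∧
        ∑ e ∈ T', Sym2.lift ⟨d, hd⟩ e < ∑ e ∈ T, Sym2.lift ⟨d, hd⟩ e) ↔
      ∃ i j k : Fin n, i ≠ j ∧ j ≠ k ∧ i ≠ k ∧ w i j + w j k + w i k < 0 := by
  have hT' : T = edgeSet (id : Fin n → Fin n) := by rw [hT]; rfl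
  clear hT
  subst hT'
  have hne1 : ∀ i : Fin n, i ≠ i + 1 := by
    intro i h'
    have := congrArg Fin.val h'
    rw [fin_succ_val hn] at this
    split_ifs at this <;> omega
  set D := Sym2.lift ⟨d, hd⟩ with hD
  have Dmk : ∀ u v, D s(u, v) = d u v := fun u v => rfl
  have sumT : ∑ e ∈ edgeSet (id : Fin n → Fin n), D e = ∑ i : Fin n, -(3 * M) := by
    rw [sum_edgeSet id hne1]
    simp only [Dmk, id, hd₁, hd₂]
    simp
  constructor
  · rintro ⟨T', hTour, hcard, hlt⟩
    have hTour0 := hTour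
    obtain ⟨σ, hc, hs, hσ⟩ := hTour
    have hsup : ∀ v, σ v ≠ v := fun v => by
      rw [← Equiv.Perm.mem_support, hs]; exact mem_univ v
    have hsq : ∀ v, σ (σ v) ≠ v := by
      intro v hv
      have h1 : σ ^ 2 = 1 := hc.pow_eq_one_iff.2 ⟨v, hsup v, by rw [pow_two]; exact hv⟩
      have h2 := orderOf_dvd_of_pow_eq_one h1
      rw [hc.orderOf, hs] at h2
      have := Nat.le_of_dvd (by norm_num) h2
      simp at this
      omega
    have nbr : ∀ v x, s(v, x) ∈ T' ↔ x = σ v ∨ v = σ x := by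
      intro v x
      rw [hσ]
      simp only [mem_image, mem_univ, true_and, Sym2.eq_iff]
      constructor
      · rintro ⟨a, ⟨rfl, rfl⟩ | ⟨rfl, rfl⟩⟩ <;> simp
      · rintro (rfl | rfl)
        · exact ⟨v, by simp⟩
        · exact ⟨x, by simp⟩
    have cardT' : T'.card = 2 * n := by
      rw [hσ, card_image_of_injective]
      · simp [mul_comm]
      · intro u v h
        simp only [Sym2.eq_iff] at h
        rcases h with h | ⟨h, h'⟩
        · exact h.1
        · subst h; exact absurd h' (hsq v)
    have cardT : (edgeSet (id : Fin n → Fin n)).card = 2 * n := card_edgeSet id hne1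
    set T := edgeSet (id : Fin n → Fin n) with hTdef
    have cardA : (T' \ T).card ≤ 3 := by
      rw [card_sdiff_comm (by omega)]; exact hcard
    have hlt' : ∑ e ∈ T' \ T, D e < ∑ e ∈ T \ T', D e := by
      have := Finset.sum_sdiff_sub_sum_sdiff (s₁ := T') (s₂ := T) (f := D)
      linarith
    -- classification of new edges
    have hA : ∀ e ∈ T' \ T, (∃ i j : Fin n, i ≠ j ∧ i ≠ j + 1 ∧ e = s((i, false), (j, true))) ∨
        (D e = 3 * M) := by
      intro e he
      rw [mem_sdiff] at he
      obtain ⟨h1, h2⟩ := he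
      induction e using Sym2.ind with
      | _ u v =>
      have huv : u ≠ v := by
        rintro rfl
        rcases (nbr _ _).1 h1 with h | h <;> exact hsup _ h.symm
      obtain ⟨a, b⟩ := u
      obtain ⟨c, b'⟩ := v
      cases b <;> cases b'
      · right; rw [Dmk]; exact hd₄ _ _ (fun h => huv (by rw [h]))
      · left
        rw [hTdef, mem_edgeSet] at h2
        push Not at h2
        exact ⟨a, c, fun h => h2.1 h.symm, h2.2, rfl⟩
      · left
        rw [Sym2.eq_swap, hTdef, mem_edgeSet] at h2
        push Not at h2
        exact ⟨c, a, fun h => h2.1 h.symm, h2.2, Sym2.eq_swap⟩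
      · right; rw [Dmk]; exact hd₅ _ _ (fun h => huv (by rw [h]))
    have hAge : ∀ e ∈ T' \ T, -M ≤ D e := by
      intro e he
      rcases hA e he with ⟨i, j, h1, h2, rfl⟩ | h
      · rw [Dmk, hd₃ i j h1 h2]; exact (abs_le.1 (hwbd i j h1)).1
      · rw [h]; linarith
    have hRle : ∀ e ∈ T, D e ≤ 0 := by
      intro e he
      simp only [hTdef, edgeSet, mem_union, mem_image, mem_univ, true_and] at he
      rcases he with ⟨a, rfl⟩ | ⟨a, rfl⟩
      · rw [Dmk]; exact (hd₁ a).le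
      · rw [Dmk, hd₂]; linarith
    have hspec : ∀ i : Fin n, s((i, true), (i + 1, false)) ∈ T' := by
      intro i
      by_contra hi
      have hm : s((i, true), (i + 1, false)) ∈ T \ T' := by
        rw [mem_sdiff]
        exact ⟨mem_union_right _ (mem_image_of_mem _ (mem_univ i)), hi⟩
      have h1 : ∑ e ∈ T \ T', D e ≤ -(3 * M) := by
        rw [← Finset.add_sum_erase _ _ hm, Dmk, hd₂]
        have : ∑ e ∈ (T \ T').erase s((i, true), (i + 1, false)), D e ≤ 0 :=
          Finset.sum_nonpos (fun e he => hRle e (mem_sdiff.1 (mem_of_mem_erase he)).1)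
        linarith
      have h2 := Finset.card_nsmul_le_sum _ _ _ hAge
      rw [nsmul_eq_mul] at h2
      have : ((T' \ T).card : ℤ) ≤ 3 := by exact_mod_cast cardA
      nlinarith
    have hA' : ∀ e ∈ T' \ T, ∃ i j : Fin n, i ≠ j ∧ i ≠ j + 1 ∧ e = s((i, false), (j, true)) := by
      intro e he
      refine (hA e he).resolve_right (fun h => ?_)
      have h0 : ∑ e ∈ T \ T', D e ≤ 0 :=
          Finset.sum_nonpos (fun e he => hRle e (mem_sdiff.1 he).1)
      have h1 := Finset.card_nsmul_le_sum ((T' \ T).erase e) D (-M)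
        (fun x hx => hAge x (mem_of_mem_erase hx))
      rw [nsmul_eq_mul] at h1
      have h2 : (((T' \ T).erase e).card : ℤ) ≤ 2 := by
        rw [card_erase_of_mem he]; omega
      rw [← Finset.add_sum_erase _ _ he, h] at hlt'
      nlinarith
    have hall : ∀ e ∈ T', ∃ i j : Fin n, e = s((i, false), (j, true)) := by
      intro e he
      by_cases heT : e ∈ T
      · simp only [hTdef, edgeSet, mem_union, mem_image, mem_univ, true_and] at heT
        rcases heT with ⟨a, rfl⟩ | ⟨a, rfl⟩
        · exact ⟨a, a, rfl⟩
        · exact ⟨a + 1, a, Sym2.eq_swap⟩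
      · obtain ⟨i, j, _, _, h⟩ := hA' e (mem_sdiff.2 ⟨he, heT⟩)
        exact ⟨i, j, h⟩
    have hex : ∀ i : Fin n, ∃ j : Fin n, s((i, false), (j, true)) ∈ T' ∧ i ≠ j + 1 := by
      intro i
      have h0 : ∀ x, x ≠ (i - 1, true) → s((i, false), x) ∈ T' →
          ∃ j : Fin n, s((i, false), (j, true)) ∈ T' ∧ i ≠ j + 1 := by
        rintro ⟨c, b⟩ hx hm
        obtain ⟨p, q, h⟩ := hall _ hm
        cases b
        · simp [Sym2.eq_iff] at h
        · refine ⟨c, hm, fun h' => hx ?_⟩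
          rw [h']; simp
      have h1 := hspec (i - 1)
      rw [sub_add_cancel, Sym2.eq_swap] at h1
      rcases (nbr _ _).1 h1 with h | h
      · refine h0 (σ.symm (i, false)) ?_ ((nbr _ _).2 (Or.inr (by simp)))
        intro h'
        rw [Equiv.symm_apply_eq, h] at h'
        exact hsq _ h'.symm
      · refine h0 (σ (i, false)) ?_ ((nbr _ _).2 (Or.inl rfl))
        intro h'
        rw [h] at h'
        exact hsq _ h'
    choose f hf hf1 using hex
    have three : ∀ v x y z, s(v, x) ∈ T' → s(v, y) ∈ T' → s(v, z) ∈ T' → x ≠ y → x ≠ z → y = z := by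
      intro v x y z hx hy hz hxy hxz
      rw [nbr] at hx hy hz
      have : ∀ a b, σ a = σ b → a = b := fun a b h => σ.injective h
      grind
    have hinj : Function.Injective f := by
      intro a b hab
      have h1 := hf a
      have h2 := hf b
      rw [← hab] at h2
      rw [Sym2.eq_swap] at h1 h2
      have := three _ _ _ _ (hspec (f a)) h1 h2
        (by intro h; exact hf1 a (Prod.mk.inj h).1.symm)
        (by intro h; rw [hab] at h; exact hf1 b (Prod.mk.inj h).1.symm)
      exact (Prod.mk.inj this).1
    have hsub : edgeSet f ⊆ T' := by
      intro e he
      simp only [edgeSet, mem_union, mem_image, mem_univ, true_and] at he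
      rcases he with ⟨a, rfl⟩ | ⟨a, rfl⟩
      · exact hf a
      · exact hspec a
    have hEq : edgeSet f = T' :=
      Finset.eq_of_subset_of_card_le hsub (by rw [card_edgeSet f hf1, cardT'])
    subst hEq
    rw [sumT, sum_edgeSet f hf1] at hlt
    simp only [Dmk, hd₂] at hlt
    have hneg : ∑ i, d (i, false) (f i, true) < 0 := by linarith
    set S : Finset (Fin n) := univ.filter (fun m => f m ≠ m) with hS
    have hScard : S.card ≤ 3 :=
      le_trans (le_sdiff_card f S hn (fun m hm => (mem_filter.1 hm).2)) hcard
    have hSum : ∑ i, d (i, false) (f i, true) = ∑ i ∈ S, w i (f i) := by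
      rw [← Finset.sum_subset (subset_univ S)]
      · refine sum_congr rfl (fun m hm => hd₃ _ _ ?_ (hf1 m))
        exact fun h => (mem_filter.1 hm).2 h.symm
      · intro m _ hm
        have : f m = m := by simpa [hS] using hm
        rw [this, hd₁]
    rw [hSum] at hneg
    have hSmem : ∀ m, m ∈ S ↔ f m ≠ m := by intro m; simp [hS]
    have hSf : ∀ m, m ∈ S → f m ∈ S := by
      intro m hm
      rw [hSmem] at hm ⊢
      exact fun h => hm (hinj h)
    clear_value S
    have h3 : S.card = 0 ∨ S.card = 1 ∨ S.card = 2 ∨ S.card = 3 := by omega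
    rcases h3 with h | h | h | h
    · rw [card_eq_zero] at h
      subst h; simp at hneg
    · obtain ⟨x, rfl⟩ := card_eq_one.1 h
      have h1 := hSf x (by simp)
      have h2 := (hSmem x).1 (by simp)
      simp at h1; exact absurd h1 h2
    · obtain ⟨x, y, hxy, rfl⟩ := card_eq_two.1 h
      have h1 := hSf x (by simp)
      have h2 := (hSmem x).1 (by simp)
      have h3 := hSf y (by simp)
      have h4 := (hSmem y).1 (by simp)
      simp only [mem_insert, mem_singleton] at h1 h3 hSmem
      have h5 := h1.resolve_left h2
      have h6 := h3.resolve_right h4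
      have h7 : ∀ m, m ≠ x → m ≠ y → f m = m := by
        intro m hx hy
        by_contra hm
        rcases (hSmem m).2 hm with h | h
        · exact hx h
        · exact hy h
      rcases lt_or_gt_of_ne hxy with hl | hl
      · exact absurd hTour0 (not_tour_swap hn x y hl f h5 h6 h7)
      · exact absurd hTour0 (not_tour_swap hn y x hl f h6 h5 (fun m a b => h7 m b a))
    · obtain ⟨x, y, z, hxy, hxz, hyz, rfl⟩ := card_eq_three.1 h
      have h1 := hSf x (by simp)
      have h2 := (hSmem x).1 (by simp)
      have h3 := hSf y (by simp)
      have h4 := (hSmem y).1 (by simp)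
      have h5 := hSf z (by simp)
      have h6 := (hSmem z).1 (by simp)
      have i1 := @hinj x y
      have i2 := @hinj x z
      have i3 := @hinj y z
      rw [sum_insert (by simp [hxy, hxz]), sum_insert (by simp [hyz]), sum_singleton] at hneg
      simp only [mem_insert, mem_singleton] at h1 h3 h5
      refine ⟨x, y, z, hxy, hyz, hxz, ?_⟩
      have w1 := hw x y
      have w2 := hw x z
      have w3 := hw y z
      grind
  · rintro ⟨i0, j0, k0, h1, h2, h3, hneg⟩
    have main : ∀ i j k : Fin n, i < j → j < k → w i j + w j k + w k i < 0 →
        ∃ T' : Finset (Sym2 (Fin n × Bool)), IsTour T' ∧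
          (edgeSet (id : Fin n → Fin n) \ T').card ≤ 3 ∧
          ∑ e ∈ T', D e < ∑ e ∈ edgeSet (id : Fin n → Fin n), D e := by
      intro i j k hij hjk hw3
      have nij : i ≠ j := hij.ne
      have njk : j ≠ k := hjk.ne
      have nik : i ≠ k := (hij.trans hjk).ne
      set f : Equiv.Perm (Fin n) := Equiv.swap i j * Equiv.swap j k with hf
      have f1 : f i = j := by
        rw [hf, Equiv.Perm.mul_apply, Equiv.swap_apply_of_ne_of_ne nij nik, Equiv.swap_apply_left]
      have f2 : f j = k := by
        rw [hf, Equiv.Perm.mul_apply, Equiv.swap_apply_left,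
          Equiv.swap_apply_of_ne_of_ne nik.symm njk.symm]
      have f3 : f k = i := by
        rw [hf, Equiv.Perm.mul_apply, Equiv.swap_apply_right, Equiv.swap_apply_right]
      have f4 : ∀ m, m ≠ i → m ≠ j → m ≠ k → f m = m := by
        intro m hi hj hk
        rw [hf, Equiv.Perm.mul_apply, Equiv.swap_apply_of_ne_of_ne hj hk,
          Equiv.swap_apply_of_ne_of_ne hi hj]
      clear_value f
      have hij' : i.val < j.val := hij
      have hjk' : j.val < k.val := hjk
      have hkn := k.isLt
      have s1 : i ≠ j + 1 := by
        intro h; have := congrArg Fin.val h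
        rw [fin_succ_val hn] at this; split_ifs at this <;> omega
      have s2 : j ≠ k + 1 := by
        intro h; have := congrArg Fin.val h
        rw [fin_succ_val hn] at this; split_ifs at this <;> omega
      have s3 : k ≠ i + 1 := by
        intro h; have := congrArg Fin.val h
        rw [fin_succ_val hn] at this; split_ifs at this <;> omega
      have hne : ∀ m, m ≠ f m + 1 := by
        intro m
        by_cases hi : m = i
        · subst hi; rw [f1]; exact s1
        by_cases hj : m = j
        · subst hj; rw [f2]; exact s2
        by_cases hk : m = k
        · subst hk; rw [f3]; exact s3
        rw [f4 m hi hj hk]; exact hne1 m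
      refine ⟨edgeSet f, tour_forward hn i j k hij hjk f f1 f2 f3 f4, ?_, ?_⟩
      · refine le_trans (sdiff_card_le f {i, j, k} ?_) card_le_three
        intro m hm
        simp only [mem_insert, mem_singleton, not_or] at hm
        exact f4 m hm.1 hm.2.1 hm.2.2
      · rw [sumT, sum_edgeSet f hne]
        simp only [Dmk, hd₂]
        have : ∑ m, d (m, false) (f m, true) = w i j + w j k + w k i := by
          rw [← Finset.sum_subset (subset_univ ({i, j, k} : Finset (Fin n)))]
          · rw [sum_insert (by simp [nij, nik]), sum_insert (by simp [njk]), sum_singleton,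
              f1, f2, f3, hd₃ i j nij s1, hd₃ j k njk s2, hd₃ k i nik.symm s3]
            ring
          · intro m _ hm
            simp only [mem_insert, mem_singleton, not_or] at hm
            rw [f4 m hm.1 hm.2.1 hm.2.2, hd₁]
        linarith
    have e1 := hw i0 j0
    have e2 := hw j0 k0
    have e3 := hw i0 k0
    rcases lt_or_gt_of_ne h1 with a | a <;> rcases lt_or_gt_of_ne h2 with b | b <;>
      rcases lt_or_gt_of_ne h3 with c | c
    · exact main i0 j0 k0 a b (by linarith)
    · exact absurd (a.trans b) (not_lt_of_gt c)
    · exact main i0 k0 j0 c b (by linarith)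
    · exact main k0 i0 j0 c a (by linarith)
    · exact main j0 i0 k0 a c (by linarith)
    · exact main j0 k0 i0 b c (by linarith)
    · exact absurd (b.trans a) (not_lt_of_gt c)
    · exact main k0 j0 i0 b a (by linarith)
end
end

section
/- Let V be a finite set with at least 3 elements, let k ≥ 1 be an integer and M > 0 a real number, and let d be a real-valued weight function on the unordered pairs of distinct elements of V such that every pair e satisfies either d(e) = −2kM or −M ≤ d(e) ≤ M. Let T and T' be edge sets of Hamiltonian cycles on V with |T \ T'| ≤ k, suppose every pair e with d(e) = −2kM belongs to T, and suppose some edge e ∈ T \ T' satisfies d(e) = −2kM. Then the total weight of T' is strictly greater than the total weight of T. -/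
noncomputable section

theorem IsTour.card_eq {V : Type} [Fintype V] [DecidableEq V] (hV : 3 ≤ Fintype.card V)
    {T : Finset (Sym2 V)} (hT : IsTour T) : T.card = Fintype.card V := by
  obtain ⟨σ, hc, hs, rfl⟩ := hT
  rw [Finset.card_image_of_injective, Finset.card_univ]
  intro v w h
  simp only [Sym2.eq_iff] at h
  rcases h with h | ⟨h1, h2⟩
  · exact h.1
  · exfalso
    have hv : σ v ≠ v := by
      rw [← Equiv.Perm.mem_support, hs]; exact Finset.mem_univ _
    have h3 : (σ ^ 2) v = v := by
      rw [pow_two, Equiv.Perm.mul_apply, h2, ← h1]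
    have h4 : σ ^ 2 = 1 := (hc.pow_eq_one_iff' hv).2 h3
    have h5 : orderOf σ ≤ 2 := orderOf_le_of_pow_eq_one (by norm_num) h4
    rw [hc.orderOf, hs, Finset.card_univ] at h5
    omega

theorem IsTour.not_diag {V : Type} [Fintype V] [DecidableEq V]
    {T : Finset (Sym2 V)} (hT : IsTour T) {x y : V} (h : s(x, y) ∈ T) : x ≠ y := by
  obtain ⟨σ, hc, hs, rfl⟩ := hT
  simp only [Finset.mem_image, Finset.mem_univ, true_and] at h
  obtain ⟨v, hv⟩ := h
  have hv' : σ v ≠ v := by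
    rw [← Equiv.Perm.mem_support, hs]; exact Finset.mem_univ _
  rintro rfl
  simp only [Sym2.eq_iff] at hv
  rcases hv with h | h <;> exact hv' (h.2.trans h.1.symm)

/-- A `k`-opt move never profits from removing an edge of weight `-2kM` when all such
edges lie on the current tour and all other weights lie in `[-M, M]`. -/
theorem stmt_12 (V : Type) [Fintype V] [DecidableEq V] (hV : 3 ≤ Fintype.card V)
    (k : ℕ) (hk : 1 ≤ k) (M : ℝ) (hM : 0 < M)
    (d : V → V → ℝ) (hd : ∀ x y, d x y = d y x)
    (hrange : ∀ x y : V, x ≠ y →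
      d x y = -(2 * k * M) ∨ (-M ≤ d x y ∧ d x y ≤ M))
    (T T' : Finset (Sym2 V)) (hT : IsTour T) (hT' : IsTour T')
    (hcard : (T \ T').card ≤ k)
    (hcheap : ∀ x y : V, x ≠ y → d x y = -(2 * k * M) → s(x, y) ∈ T)
    (hrem : ∃ e ∈ T \ T', Sym2.lift ⟨d, hd⟩ e = -(2 * k * M)) :
    ∑ e ∈ T, Sym2.lift ⟨d, hd⟩ e < ∑ e ∈ T', Sym2.lift ⟨d, hd⟩ e := by
  have hcT := hT.card_eq hV
  have hcT' := hT'.card_eq hV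
  have hcard2 : (T' \ T).card = (T \ T').card := by
    have h1 := Finset.card_sdiff_add_card_inter T T'
    have h2 := Finset.card_sdiff_add_card_inter T' T
    rw [Finset.inter_comm] at h2
    omega
  set f : Sym2 V → ℝ := Sym2.lift ⟨d, hd⟩ with hf
  have hkM : 0 ≤ 2 * (k : ℝ) * M := by positivity
  have hlow : ∀ e ∈ T' \ T, -M ≤ f e := by
    intro e
    induction e using Sym2.ind with
    | _ x y =>
      intro he
      rw [Finset.mem_sdiff] at he
      have hxy := hT'.not_diag he.1
      rcases hrange x y hxy with h | h
      · exact absurd (hcheap x y hxy h) he.2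
      · exact h.1
  have hup : ∀ e ∈ T, f e ≤ M := by
    intro e
    induction e using Sym2.ind with
    | _ x y =>
      intro he
      have hxy := hT.not_diag he
      change d x y ≤ M
      rcases hrange x y hxy with h | h
      · linarith
      · exact h.2
  obtain ⟨e, he, hde⟩ := hrem
  have hA : ((T' \ T).card : ℝ) * (-M) ≤ ∑ e ∈ T' \ T, f e := by
    rw [← nsmul_eq_mul]
    exact Finset.card_nsmul_le_sum _ _ _ hlow
  have hB : ∑ e ∈ (T \ T').erase e, f e ≤ (((T \ T').erase e).card : ℝ) * M := by
    rw [← nsmul_eq_mul]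
    exact Finset.sum_le_card_nsmul _ _ _ fun a ha =>
      hup a (Finset.mem_sdiff.1 (Finset.mem_of_mem_erase ha)).1
  have hC := Finset.add_sum_erase (T \ T') f he
  have hD : (((T \ T').erase e).card : ℝ) + 1 = ((T \ T').card : ℝ) := by
    exact_mod_cast Finset.card_erase_add_one he
  have hE := Finset.sum_inter_add_sum_sdiff T T' f
  have hF := Finset.sum_inter_add_sum_sdiff T' T f
  rw [Finset.inter_comm] at hF
  rw [hcard2] at hA
  have hm : ((T \ T').card : ℝ) * M ≤ k * M := by
    have : ((T \ T').card : ℝ) ≤ k := by exact_mod_cast hcard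
    gcongr
  have hB' : (((T \ T').erase e).card : ℝ) * M = ((T \ T').card : ℝ) * M - M := by
    rw [← hD]; ring
  linarith
end
end
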